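/- arXiv:1511.08329 — 6 statements merged into one kernel-verified Lean document; each statement's English description precedes it below -/
import Mathlib

section
/- Let E be a finite-dimensional real inner product space, N a norm on E, S : E → E a positive definite self-adjoint linear map, T : E → E a linear map, and c₁, c₂, c₃, c₄ > 0 constants such that c₁ N(w)² ≤ ⟨S⁻¹ w, w⟩ ≤ c₂ N(w)² for all w ∈ E, and c₃ N(v) ≤ sup_{w ≠ 0} ⟨T v, w⟩ / N(w) ≤ c₄ N(v) for all v ∈ E. Then (c₃/√c₂) N(v) ≤ ⟨T* S T v, v⟩^{1/2} ≤ (c₄/√c₁) N(v) for all v ∈ E. (This is the abstract content of Lemmas 3.1, 6.3 and 6.4 of the paper: the preconditioned quadratic form ⟨T*STv,v⟩^{1/2} is equivalent to any norm N for which S⁻¹ induces an equivalent quadratic form and T satisfies a two-sided stability estimate.) -/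
open RealInnerProductSpace

/-- Abstract content of Lemmas 3.1, 6.3 and 6.4: the preconditioned quadratic form
`⟨T*STv,v⟩^{1/2}` is equivalent to any norm `N` for which `S⁻¹` induces an equivalent
quadratic form and `T` satisfies a two-sided stability estimate. -/
theorem stmt1 {E : Type*} [NormedAddCommGroup E] [InnerProductSpace ℝ E]
    [FiniteDimensional ℝ E]
    (T S Sinv : E →ₗ[ℝ] E) (N : E → ℝ)
    (hN0 : ∀ v : E, N v = 0 ↔ v = 0)
    (hNsmul : ∀ (a : ℝ) (v : E), N (a • v) = |a| * N v)
    (hNadd : ∀ v w : E, N (v + w) ≤ N v + N w)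
    (hS : LinearMap.adjoint S = S)
    (hSpos : ∀ v : E, v ≠ 0 → 0 < ⟪S v, v⟫)
    (hinv₁ : S ∘ₗ Sinv = LinearMap.id)
    (hinv₂ : Sinv ∘ₗ S = LinearMap.id)
    (c₁ c₂ c₃ c₄ : ℝ) (hc₁ : 0 < c₁) (hc₂ : 0 < c₂) (hc₃ : 0 < c₃) (hc₄ : 0 < c₄)
    (hlow : ∀ w : E, c₁ * (N w) ^ 2 ≤ ⟪Sinv w, w⟫)
    (hhigh : ∀ w : E, ⟪Sinv w, w⟫ ≤ c₂ * (N w) ^ 2)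
    (hstab₁ : ∀ v : E,
      c₃ * N v ≤ ⨆ w : {w : E // w ≠ 0}, ⟪T v, (w : E)⟫ / N (w : E))
    (hstab₂ : ∀ v : E,
      (⨆ w : {w : E // w ≠ 0}, ⟪T v, (w : E)⟫ / N (w : E)) ≤ c₄ * N v)
    (v : E) :
    (c₃ / Real.sqrt c₂) * N v ≤ Real.sqrt ⟪(LinearMap.adjoint T) (S (T v)), v⟫ ∧
      Real.sqrt ⟪(LinearMap.adjoint T) (S (T v)), v⟫ ≤ (c₄ / Real.sqrt c₁) * N v := by
  have hsym : ∀ x y : E, ⟪S x, y⟫ = ⟪x, S y⟫ := by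
    intro x y
    conv_lhs => rw [← hS]
    exact LinearMap.adjoint_inner_left S y x
  have hSnn : ∀ x : E, 0 ≤ ⟪S x, x⟫ := by
    intro x
    by_cases hx : x = 0
    · simp [hx]
    · exact (hSpos x hx).le
  have hNnn : ∀ x : E, 0 ≤ N x := by
    intro x
    have h1 := hNadd x ((-1 : ℝ) • x)
    have h2 : x + (-1 : ℝ) • x = 0 := by simp
    rw [h2, (hN0 0).2 rfl, hNsmul] at h1
    norm_num at h1
    linarith
  have hNpos : ∀ x : E, x ≠ 0 → 0 < N x := fun x hx =>
    lt_of_le_of_ne (hNnn x) (fun h => hx ((hN0 x).1 h.symm))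
  have hSS : ∀ x, S (Sinv x) = x := fun x => LinearMap.congr_fun hinv₁ x
  have hSS2 : ∀ x, Sinv (S x) = x := fun x => LinearMap.congr_fun hinv₂ x
  have hCS : ∀ x z : E, ⟪x, S z⟫ ^ 2 ≤ ⟪S x, x⟫ * ⟪S z, z⟫ := by
    intro x z
    have h := discrim_le_zero (a := ⟪S z, z⟫) (b := 2 * ⟪x, S z⟫) (c := ⟪S x, x⟫) (by
      intro t
      have h0 := hSnn (x + t • z)
      simp only [map_add, map_smul, inner_add_left, inner_add_right, inner_smul_left,
        inner_smul_right, RCLike.conj_to_real] at h0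
      rw [hsym x z, real_inner_comm x (S z)] at h0
      linarith)
    unfold discrim at h
    nlinarith
  rw [LinearMap.adjoint_inner_left]
  set u := T v with hu
  set q := ⟪S u, u⟫ with hq
  have hq0 : 0 ≤ q := hSnn u
  have hs1 : 0 < Real.sqrt c₁ := Real.sqrt_pos.2 hc₁
  have hs2 : 0 < Real.sqrt c₂ := Real.sqrt_pos.2 hc₂
  have hbd : ∀ w : {w : E // w ≠ 0}, ⟪u, (w : E)⟫ / N (w : E) ≤ Real.sqrt q * Real.sqrt c₂ := by
    rintro ⟨w, hw⟩
    rw [div_le_iff₀ (hNpos w hw)]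
    have hnw := hNnn w
    refine le_trans (le_abs_self _) (abs_le_of_sq_le_sq ?_ (by positivity))
    have h := hCS u (Sinv w)
    rw [hSS, ← hq, real_inner_comm (Sinv w) w] at h
    have h2 := hhigh w
    rw [mul_pow, mul_pow, Real.sq_sqrt hq0, Real.sq_sqrt hc₂.le, mul_assoc]
    exact h.trans (mul_le_mul_of_nonneg_left h2 hq0)
  constructor
  · have h := (hstab₁ v).trans (Real.iSup_le hbd (by positivity))
    rw [div_mul_eq_mul_div, div_le_iff₀ hs2]
    exact h
  · by_cases hu0 : u = 0
    · have : q = 0 := by simp [hq, hu0]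
      rw [this, Real.sqrt_zero]
      have := hNnn v
      positivity
    · have hqpos : 0 < q := hSpos u hu0
      have hw : S u ≠ 0 := by
        intro h
        rw [hq, h, inner_zero_left] at hqpos
        exact lt_irrefl _ hqpos
      have h1 := (le_ciSup (f := fun w : {w : E // w ≠ 0} => ⟪u, (w : E)⟫ / N (w : E))
        ⟨_, Set.forall_mem_range.2 hbd⟩ ⟨S u, hw⟩).trans (hstab₂ v)
      simp only at h1
      rw [← hsym u u, ← hq, div_le_iff₀ (hNpos _ hw)] at h1
      have h2 := hlow (S u)
      rw [hSS2, ← hsym u u, ← hq] at h2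
      have h3 : Real.sqrt c₁ * N (S u) ≤ Real.sqrt q := by
        apply Real.le_sqrt_of_sq_le
        rw [mul_pow, Real.sq_sqrt hc₁.le]
        exact h2
      rw [div_mul_eq_mul_div, le_div_iff₀ hs1]
      have hsq : 0 < Real.sqrt q := Real.sqrt_pos.2 hqpos
      have h4 : Real.sqrt q * Real.sqrt q = q := Real.mul_self_sqrt hq0
      have h5 : 0 ≤ c₄ * N v := mul_nonneg hc₄.le (hNnn v)
      refine le_of_mul_le_mul_right ?_ hsq
      calc Real.sqrt q * Real.sqrt c₁ * Real.sqrt q = q * Real.sqrt c₁ := by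
            linear_combination Real.sqrt c₁ * h4
        _ ≤ c₄ * N v * N (S u) * Real.sqrt c₁ := by gcongr
        _ = c₄ * N v * (Real.sqrt c₁ * N (S u)) := by ring
        _ ≤ c₄ * N v * Real.sqrt q := by gcongr
end

section
/- For every real number τ ∈ [0,1], every integer m ≥ 1, and every real number t ∈ [0,1], one has t^τ (1 − t)^{2m} ≤ (τ/(2m))^τ, where the powers with real exponent are real powers with the convention 0^0 = 1. (This scalar inequality is the heart of the smoothing property, Lemma 5.1 of the paper, for the damped Richardson relaxation.) -/
/-- The scalar inequality at the heart of the smoothing property (Lemma 5.1):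
`t^τ (1 − t)^{2m} ≤ (τ/(2m))^τ` for `τ ∈ [0,1]`, `m ≥ 1`, `t ∈ [0,1]`,
with real powers following the convention `0^0 = 1`. -/
theorem stmt2 (τ : ℝ) (hτ0 : 0 ≤ τ) (hτ1 : τ ≤ 1) (m : ℕ) (hm : 1 ≤ m)
    (t : ℝ) (ht0 : 0 ≤ t) (ht1 : t ≤ 1) :
    t ^ τ * (1 - t) ^ (2 * m) ≤ (τ / (2 * (m : ℝ))) ^ τ := by
  have hm' : (0 : ℝ) < m := by exact_mod_cast hm
  rcases hτ0.eq_or_lt with h | h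
  · subst h
    simp only [Real.rpow_zero, one_mul]
    exact pow_le_one₀ (by linarith) (by linarith)
  · have h1 : (1 - t) ^ (2 * m) ≤ (Real.exp (-(2 * m / τ * t))) ^ τ := by
      calc (1 - t) ^ (2 * m) ≤ (Real.exp (-t)) ^ (2 * m) :=
            pow_le_pow_left₀ (by linarith) (Real.one_sub_le_exp_neg t) _
        _ = (Real.exp (-(2 * m / τ * t))) ^ τ := by
            rw [← Real.exp_nat_mul, ← Real.exp_mul]
            congr 1
            push_cast
            field_simp
    have h2 : t * Real.exp (-(2 * m / τ * t)) ≤ τ / (2 * (m : ℝ)) := by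
      have h3 := Real.add_one_le_exp (2 * m / τ * t)
      rw [Real.exp_neg, ← div_eq_mul_inv, div_le_iff₀ (Real.exp_pos _)]
      calc t = τ / (2 * (m : ℝ)) * (2 * m / τ * t) := by field_simp
        _ ≤ _ := mul_le_mul_of_nonneg_left (by linarith) (by positivity)
    calc t ^ τ * (1 - t) ^ (2 * m) ≤ t ^ τ * (Real.exp (-(2 * m / τ * t))) ^ τ :=
          mul_le_mul_of_nonneg_left h1 (Real.rpow_nonneg ht0 _)
      _ = (t * Real.exp (-(2 * m / τ * t))) ^ τ :=
          (Real.mul_rpow ht0 (Real.exp_pos _).le).symm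
      _ ≤ _ := Real.rpow_le_rpow (by positivity) h2 hτ0
end

section
/- Let E be a finite-dimensional real inner product space, A : E → E a positive semidefinite self-adjoint linear map, and δ > 0 a real number such that δ ⟨A v, v⟩ ≤ ⟨v, v⟩ for all v ∈ E. Then for every real τ ∈ [0,1], every integer m ≥ 1, and every x ∈ E, ⟨A (I − δA)^m x, (I − δA)^m x⟩ ≤ (τ/(2m))^τ · δ^{−τ} · ⟨A^{1−τ} x, x⟩, with the convention 0^0 = 1. (This is the abstract spectral form of the smoothing property, Lemma 5.1 of the paper, for the damped Richardson smoother R = I − δA.) -/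
open RealInnerProductSpace

theorem aux_scalar (lam δ τ : ℝ) (hl : 0 ≤ lam) (hδ : 0 < δ) (hle : δ * lam ≤ 1)
    (hτ0 : 0 ≤ τ) (m : ℕ) (hm : 1 ≤ m) :
    lam * ((1 - δ * lam) ^ m) ^ 2 ≤ (τ / (2 * (m : ℝ))) ^ τ * δ ^ (-τ) * lam ^ (1 - τ) := by
  have hm0 : (0 : ℝ) < m := by exact_mod_cast hm
  rcases hl.eq_or_lt with h0 | hpos
  · rw [← h0]
    simp only [zero_mul]
    positivity
  have hn : 0 ≤ 1 - δ * lam := by linarith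
  have key : ((1 - δ * lam) ^ m) ^ 2 * (δ * lam) ^ τ ≤ (τ / (2 * (m : ℝ))) ^ τ := by
    rcases hτ0.eq_or_lt with h0 | hτ
    · rw [← h0]
      simp only [Real.rpow_zero, mul_one]
      have : (1 - δ * lam) ^ m ≤ 1 := pow_le_one₀ hn (by nlinarith [mul_pos hδ hpos])
      exact pow_le_one₀ (by positivity) this
    · set t := δ * lam with ht
      have htp : 0 < t := mul_pos hδ hpos
      have h1 : ((1 - t) ^ m) ^ 2 ≤ Real.exp (-(2 * m * t)) := by
        have : 1 - t ≤ Real.exp (-t) := Real.one_sub_le_exp_neg t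
        calc ((1 - t) ^ m) ^ 2 ≤ (Real.exp (-t) ^ m) ^ 2 := by gcongr
          _ = Real.exp (-(2 * m * t)) := by
            rw [← Real.exp_nat_mul, ← Real.exp_nat_mul]
            congr 1
            push_cast
            ring
      have h2 : (2 * m * t / τ) ^ τ ≤ Real.exp (2 * m * t) := by
        have hy : 2 * m * t / τ ≤ Real.exp (2 * m * t / τ) := by
          linarith [Real.add_one_le_exp (2 * m * t / τ)]
        calc (2 * m * t / τ) ^ τ ≤ (Real.exp (2 * m * t / τ)) ^ τ :=
              Real.rpow_le_rpow (by positivity) hy hτ0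
          _ = Real.exp (2 * m * t) := by
            rw [← Real.exp_mul]
            congr 1
            field_simp
      have h3 : t ^ τ = (τ / (2 * (m : ℝ))) ^ τ * (2 * m * t / τ) ^ τ := by
        rw [← Real.mul_rpow (by positivity) (by positivity)]
        congr 1
        field_simp
      rw [h3]
      calc ((1 - t) ^ m) ^ 2 * ((τ / (2 * (m : ℝ))) ^ τ * (2 * m * t / τ) ^ τ)
          ≤ Real.exp (-(2 * m * t)) * ((τ / (2 * (m : ℝ))) ^ τ * Real.exp (2 * m * t)) := by
            gcongr
        _ = (τ / (2 * (m : ℝ))) ^ τ := by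
            rw [mul_left_comm, ← Real.exp_add]
            simp
  rw [Real.mul_rpow hδ.le hl] at key
  have e1 : lam = δ ^ (-τ) * lam ^ (1 - τ) * (δ ^ τ * lam ^ τ) := by
    have a : δ ^ (-τ) * δ ^ τ = 1 := by rw [← Real.rpow_add hδ]; simp
    have b : lam ^ (1 - τ) * lam ^ τ = lam := by rw [← Real.rpow_add hpos]; simp
    calc lam = (δ ^ (-τ) * δ ^ τ) * (lam ^ (1 - τ) * lam ^ τ) := by rw [a, b, one_mul]
      _ = _ := by ring
  have h5 : 0 ≤ δ ^ (-τ) * lam ^ (1 - τ) := by positivity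
  have h6 := mul_le_mul_of_nonneg_left key h5
  generalize ((1 - δ * lam) ^ m) ^ 2 = Q at *
  calc lam * Q = (δ ^ (-τ) * lam ^ (1 - τ) * (δ ^ τ * lam ^ τ)) * Q := by rw [← e1]
    _ = δ ^ (-τ) * lam ^ (1 - τ) * (Q * (δ ^ τ * lam ^ τ)) := by ring
    _ ≤ _ := h6
    _ = _ := by ring

theorem aux_coord {E ι : Type*} [NormedAddCommGroup E] [InnerProductSpace ℝ E] [Fintype ι]
    (b : OrthonormalBasis ι ℝ E) (T : E →ₗ[ℝ] E) (c : ι → ℝ) (h : ∀ i, T (b i) = c i • b i)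
    (x : E) (j : ι) : ⟪b j, T x⟫ = c j * ⟪b j, x⟫ := by
  classical
  conv_lhs => rw [← b.sum_repr' x]
  simp [map_sum, h, inner_sum, inner_smul_right, b.inner_eq_ite, mul_comm]

theorem aux_quad {E ι : Type*} [NormedAddCommGroup E] [InnerProductSpace ℝ E] [Fintype ι]
    (b : OrthonormalBasis ι ℝ E) (T : E →ₗ[ℝ] E) (c : ι → ℝ) (h : ∀ i, T (b i) = c i • b i)
    (x : E) : ⟪T x, x⟫ = ∑ i, c i * ⟪b i, x⟫ ^ 2 := by
  rw [← b.sum_inner_mul_inner]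
  refine Finset.sum_congr rfl fun i _ => ?_
  rw [real_inner_comm, aux_coord b T c h]
  ring

/-- Abstract spectral form of the smoothing property (Lemma 5.1) for the damped
Richardson smoother `R = I − δA`.  The fractional power `A^{1−τ}` is encoded by an
operator `A1mτ` acting as multiplication by `μ^{1−τ}` on each eigenspace of `A`
(with the convention `0^0 = 1`, which is built into `Real.rpow`). -/
theorem stmt4 {E : Type*} [NormedAddCommGroup E] [InnerProductSpace ℝ E]
    [FiniteDimensional ℝ E]
    (A A1mτ : E →ₗ[ℝ] E)
    (hA : LinearMap.adjoint A = A)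
    (hApos : ∀ v : E, 0 ≤ ⟪A v, v⟫)
    (δ : ℝ) (hδ : 0 < δ)
    (hδA : ∀ v : E, δ * ⟪A v, v⟫ ≤ ⟪v, v⟫)
    (τ : ℝ) (hτ0 : 0 ≤ τ) (hτ1 : τ ≤ 1)
    (hfrac : ∀ (μ : ℝ) (v : E), A v = μ • v → A1mτ v = μ ^ (1 - τ) • v)
    (m : ℕ) (hm : 1 ≤ m) (x : E) :
    ⟪A ((((1 : E →ₗ[ℝ] E) - δ • A) ^ m) x), (((1 : E →ₗ[ℝ] E) - δ • A) ^ m) x⟫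
      ≤ (τ / (2 * (m : ℝ))) ^ τ * δ ^ (-τ) * ⟪A1mτ x, x⟫ := by
  have hsym : A.IsSymmetric := (LinearMap.isSymmetric_iff_isSelfAdjoint A).2 hA
  let b := hsym.eigenvectorBasis rfl
  let l := hsym.eigenvalues rfl
  have hb : ∀ i, A (b i) = l i • b i := fun i => hsym.apply_eigenvectorBasis rfl i
  have hbb : ∀ i, ⟪b i, b i⟫ = 1 := fun i => by
    rw [real_inner_self_eq_norm_sq, b.norm_eq_one]; norm_num
  have hAb : ∀ i, ⟪A (b i), b i⟫ = l i := fun i => by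
    rw [hb, real_inner_smul_left, hbb, mul_one]
  have hR : ∀ i, (((1 : E →ₗ[ℝ] E) - δ • A) ^ m) (b i) = (1 - δ * l i) ^ m • b i := by
    intro i
    clear hm
    induction m with
    | zero => simp
    | succ k ih =>
      rw [pow_succ', Module.End.mul_apply, ih, map_smul]
      simp only [LinearMap.sub_apply, LinearMap.smul_apply, Module.End.one_apply, hb]
      module
  rw [aux_quad b A l hb, aux_quad b A1mτ _ (fun i => hfrac _ _ (hb i)), Finset.mul_sum]
  refine Finset.sum_le_sum fun i _ => ?_
  rw [aux_coord b _ _ hR, mul_pow, ← mul_assoc, ← mul_assoc]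
  refine mul_le_mul_of_nonneg_right ?_ (sq_nonneg _)
  have h1 := hApos (b i)
  have h2 := hδA (b i)
  rw [hAb] at h1 h2
  rw [hbb] at h2
  exact aux_scalar (l i) δ τ h1 hδ h2 hτ0 m hm
end

section
/- Let E be a finite-dimensional real inner product space, and let A, B : E → E be positive semidefinite self-adjoint linear maps such that c₁ ⟨B x, x⟩ ≤ ⟨A x, x⟩ ≤ c₂ ⟨B x, x⟩ for all x ∈ E, where c₁, c₂ > 0. Then for every real s ∈ [0,1] and every x ∈ E, c₁^s ⟨B^s x, x⟩ ≤ ⟨A^s x, x⟩ ≤ c₂^s ⟨B^s x, x⟩. (This interpolation of quadratic-form equivalences between Hilbert scales is the tool used to establish the norm equivalences (4.13) and (6.36) of the paper for the intermediate mesh-dependent norms.) -/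
open RealInnerProductSpace

theorem quad_aux {E : Type*} [NormedAddCommGroup E] [InnerProductSpace ℝ E]
    {n : ℕ} (b : OrthonormalBasis (Fin n) ℝ E) (T : E →ₗ[ℝ] E) (m : Fin n → ℝ)
    (h : ∀ i, T (b i) = m i • b i) (x : E) :
    ⟪T x, x⟫ = ∑ i, m i * (b.repr x i) ^ 2 := by
  have h1 : T x = ∑ i, (b.repr x i) • (m i • b i) := by
    conv_lhs => rw [← b.sum_repr x]
    rw [map_sum]
    simp only [map_smul, h]
  rw [h1, sum_inner]
  refine Finset.sum_congr rfl fun i _ => ?_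
  rw [real_inner_smul_left, real_inner_smul_left, ← b.repr_apply_apply]
  ring

theorem scal_aux (l t a y : ℝ) (hl : 0 ≤ l) (ht : 0 < t) :
    l * t / (t + l) * a ^ 2 ≤ l * (a - y) ^ 2 + t * y ^ 2 := by
  have h : 0 < t + l := by positivity
  have : l * (a - y) ^ 2 + t * y ^ 2 - l * t / (t + l) * a ^ 2
      = ((t + l) * y - l * a) ^ 2 / (t + l) := by
    field_simp
    ring
  have h2 : 0 ≤ ((t + l) * y - l * a) ^ 2 / (t + l) := by positivity
  linarith

theorem res_aux {E : Type*} [NormedAddCommGroup E] [InnerProductSpace ℝ E]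
    {n : ℕ} (u v : OrthonormalBasis (Fin n) ℝ E) (A B : E →ₗ[ℝ] E) (l m : Fin n → ℝ)
    (hl : ∀ i, A (u i) = l i • u i) (hm : ∀ i, B (v i) = m i • v i)
    (hl0 : ∀ i, 0 ≤ l i) (hm0 : ∀ i, 0 ≤ m i)
    (hAB : ∀ x : E, ⟪A x, x⟫ ≤ ⟪B x, x⟫) (t : ℝ) (ht : 0 < t) (x : E) :
    ∑ i, l i * t / (t + l i) * (u.repr x i) ^ 2 ≤
      ∑ i, m i * t / (t + m i) * (v.repr x i) ^ 2 := by
  let w : EuclideanSpace ℝ (Fin n) := WithLp.toLp 2 fun j => m j / (t + m j) * v.repr x j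
  let y : E := v.repr.symm w
  have hy : ∀ j, v.repr y j = m j / (t + m j) * v.repr x j := by
    intro j; simp [y, w]
  have e1 := quad_aux u A l hl (x - y)
  have e2 := quad_aux v B m hm (x - y)
  have e3 := quad_aux u LinearMap.id (fun _ => 1) (by simp) y
  have e4 := quad_aux v LinearMap.id (fun _ => 1) (by simp) y
  calc ∑ i, l i * t / (t + l i) * (u.repr x i) ^ 2
      ≤ ∑ i, (l i * (u.repr (x - y) i) ^ 2 + t * (1 * (u.repr y i) ^ 2)) := by
        refine Finset.sum_le_sum fun i _ => ?_
        have := scal_aux (l i) t (u.repr x i) (u.repr y i) (hl0 i) ht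
        simpa using this
    _ = ⟪A (x - y), x - y⟫ + t * ⟪y, y⟫ := by
        rw [Finset.sum_add_distrib, ← Finset.mul_sum, ← e1, ← e3]; rfl
    _ ≤ ⟪B (x - y), x - y⟫ + t * ⟪y, y⟫ := by gcongr; exact hAB _
    _ = ∑ i, (m i * (v.repr (x - y) i) ^ 2 + t * (1 * (v.repr y i) ^ 2)) := by
        rw [Finset.sum_add_distrib, ← Finset.mul_sum, ← e2, ← e4]; rfl
    _ = _ := by
        refine Finset.sum_congr rfl fun i _ => ?_
        have h : t + m i ≠ 0 := by have := hm0 i; positivity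
        rw [map_sub, PiLp.sub_apply, hy]
        field_simp
        ring

theorem int_aux {n : ℕ} (l m a b : Fin n → ℝ) (hl0 : ∀ i, 0 ≤ l i) (hm0 : ∀ i, 0 ≤ m i)
    (h : ∀ t : ℝ, 0 < t → ∑ i, l i * t / (t + l i) * a i ^ 2 ≤ ∑ i, m i * t / (t + m i) * b i ^ 2)
    (s : ℝ) (hs : s ∈ Set.Ioo (0 : ℝ) 1) :
    ∑ i, l i ^ s * a i ^ 2 ≤ ∑ i, m i ^ s * b i ^ 2 := by
  set C := ∫ t in Set.Ioi (0 : ℝ), Real.rpowIntegrand₀₁ s t 1 with hC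
  have hCpos : 0 < C := Real.integral_rpowIntegrand₀₁_one_pos hs
  have key : ∀ (l a : Fin n → ℝ), (∀ i, 0 ≤ l i) →
      (MeasureTheory.IntegrableOn (fun t => ∑ i, Real.rpowIntegrand₀₁ s t (l i) * a i ^ 2)
        (Set.Ioi (0 : ℝ))) ∧
      ∫ t in Set.Ioi (0 : ℝ), ∑ i, Real.rpowIntegrand₀₁ s t (l i) * a i ^ 2 =
        C * ∑ i, l i ^ s * a i ^ 2 := by
    intro l a hl0
    have hi : ∀ i ∈ Finset.univ, MeasureTheory.Integrable
        (fun t => Real.rpowIntegrand₀₁ s t (l i) * a i ^ 2)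
        (MeasureTheory.volume.restrict (Set.Ioi (0 : ℝ))) := fun i _ =>
      MeasureTheory.Integrable.mul_const
        (Real.integrableOn_rpowIntegrand₀₁_Ioi hs (hl0 i)) _
    refine ⟨MeasureTheory.integrable_finsetSum _ hi, ?_⟩
    rw [MeasureTheory.integral_finsetSum _ hi, Finset.mul_sum]
    refine Finset.sum_congr rfl fun i _ => ?_
    rw [MeasureTheory.integral_mul_const,
      Real.integral_rpowIntegrand₀₁_eq_rpow_mul_const hs (hl0 i)]
    ring
  obtain ⟨i1, e1⟩ := key l a hl0
  obtain ⟨i2, e2⟩ := key m b hm0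
  refine le_of_mul_le_mul_left ?_ hCpos
  rw [← e1, ← e2]
  refine MeasureTheory.setIntegral_mono_on i1 i2 measurableSet_Ioi fun t ht => ?_
  have ht : 0 < t := ht
  have e : ∀ (l a : Fin n → ℝ), (∀ i, 0 ≤ l i) →
      ∑ i, Real.rpowIntegrand₀₁ s t (l i) * a i ^ 2 =
      t ^ (s - 1) / t * ∑ i, l i * t / (t + l i) * a i ^ 2 := by
    intro l a hl0
    rw [Finset.mul_sum]
    refine Finset.sum_congr rfl fun i _ => ?_
    rw [Real.rpowIntegrand₀₁_eq_pow_div hs ht.le (hl0 i)]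
    have := hl0 i
    field_simp
  rw [e l a hl0, e m b hm0]
  exact mul_le_mul_of_nonneg_left (h t ht) (by positivity)

theorem main_aux {E : Type*} [NormedAddCommGroup E] [InnerProductSpace ℝ E]
    [FiniteDimensional ℝ E]
    (A B As Bs : E →ₗ[ℝ] E)
    (hA : A.IsSymmetric) (hApos : ∀ v : E, 0 ≤ ⟪A v, v⟫)
    (hB : B.IsSymmetric) (hBpos : ∀ v : E, 0 ≤ ⟪B v, v⟫)
    (hAB : ∀ x : E, ⟪A x, x⟫ ≤ ⟪B x, x⟫)
    (s : ℝ) (hs0 : 0 ≤ s) (hs1 : s ≤ 1)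
    (hfracA : ∀ (μ : ℝ) (v : E), 0 ≤ μ → A v = μ • v → As v = μ ^ s • v)
    (hfracB : ∀ (μ : ℝ) (v : E), 0 ≤ μ → B v = μ • v → Bs v = μ ^ s • v)
    (x : E) : ⟪As x, x⟫ ≤ ⟪Bs x, x⟫ := by
  have diag : ∀ (T : E →ₗ[ℝ] E), T.IsSymmetric → (∀ v : E, 0 ≤ ⟪T v, v⟫) →
      ∃ (u : OrthonormalBasis (Fin (Module.finrank ℝ E)) ℝ E)
        (l : Fin (Module.finrank ℝ E) → ℝ), (∀ i, T (u i) = l i • u i) ∧ ∀ i, 0 ≤ l i := by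
    intro T hT hp
    refine ⟨hT.eigenvectorBasis rfl, hT.eigenvalues rfl, fun i => ?_, fun i => ?_⟩
    · simpa using hT.apply_eigenvectorBasis rfl i
    · have := hp (hT.eigenvectorBasis rfl i)
      rw [hT.apply_eigenvectorBasis rfl i] at this
      simpa [real_inner_smul_left] using this
  obtain ⟨u, l, hl, hl0⟩ := diag A hA hApos
  obtain ⟨v, m, hm, hm0⟩ := diag B hB hBpos
  have eA := quad_aux u As (fun i => l i ^ s) (fun i => hfracA _ _ (hl0 i) (hl i)) x
  have eB := quad_aux v Bs (fun i => m i ^ s) (fun i => hfracB _ _ (hm0 i) (hm i)) x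
  rcases hs0.eq_or_lt with rfl | hs0
  · have e3 := quad_aux u LinearMap.id (fun _ => 1) (by simp) x
    have e4 := quad_aux v LinearMap.id (fun _ => 1) (by simp) x
    simp only [Real.rpow_zero] at eA eB
    rw [eA, eB, ← e3, ← e4]
  rcases hs1.eq_or_lt with rfl | hs1
  · simp only [Real.rpow_one] at eA eB
    rw [eA, eB, ← quad_aux u A l hl, ← quad_aux v B m hm]
    exact hAB x
  rw [eA, eB]
  exact int_aux l m _ _ hl0 hm0
    (fun t ht => res_aux u v A B l m hl hm hl0 hm0 hAB t ht x) s ⟨hs0, hs1⟩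

/-- Interpolation of quadratic-form equivalences between Hilbert scales, the tool behind
the norm equivalences (4.13) and (6.36).  The fractional powers `A^s`, `B^s` are encoded
by operators `As`, `Bs` acting as multiplication by `μ^s` on each eigenspace
(convention `0^0 = 1`). -/
theorem stmt6 {E : Type*} [NormedAddCommGroup E] [InnerProductSpace ℝ E]
    [FiniteDimensional ℝ E]
    (A B As Bs : E →ₗ[ℝ] E)
    (hA : LinearMap.adjoint A = A)
    (hApos : ∀ v : E, 0 ≤ ⟪A v, v⟫)
    (hB : LinearMap.adjoint B = B)
    (hBpos : ∀ v : E, 0 ≤ ⟪B v, v⟫)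
    (c₁ c₂ : ℝ) (hc₁ : 0 < c₁) (hc₂ : 0 < c₂)
    (hlow : ∀ x : E, c₁ * ⟪B x, x⟫ ≤ ⟪A x, x⟫)
    (hhigh : ∀ x : E, ⟪A x, x⟫ ≤ c₂ * ⟪B x, x⟫)
    (s : ℝ) (hs0 : 0 ≤ s) (hs1 : s ≤ 1)
    (hfracA : ∀ (μ : ℝ) (v : E), A v = μ • v → As v = μ ^ s • v)
    (hfracB : ∀ (μ : ℝ) (v : E), B v = μ • v → Bs v = μ ^ s • v)
    (x : E) :
    c₁ ^ s * ⟪Bs x, x⟫ ≤ ⟪As x, x⟫ ∧ ⟪As x, x⟫ ≤ c₂ ^ s * ⟪Bs x, x⟫ := by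
  have sym : ∀ T : E →ₗ[ℝ] E, LinearMap.adjoint T = T → T.IsSymmetric := fun T hT =>
    (LinearMap.isSymmetric_iff_isSelfAdjoint T).2 hT
  have hcB : ∀ c : ℝ, 0 < c → ∀ (μ : ℝ) (v : E), 0 ≤ μ → (c • B) v = μ • v →
      (c ^ s • Bs) v = μ ^ s • v := by
    intro c hc μ v hμ h
    have h1 : B v = (μ / c) • v := by
      rw [LinearMap.smul_apply] at h
      rw [div_eq_inv_mul, mul_smul, ← h, smul_smul, inv_mul_cancel₀ hc.ne', one_smul]
    rw [LinearMap.smul_apply, hfracB _ _ h1, smul_smul, ← Real.mul_rpow hc.le (by positivity),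
      mul_div_cancel₀ _ hc.ne']
  have hsB : ∀ c : ℝ, (c • B).IsSymmetric := by
    intro c y z
    simp only [LinearMap.smul_apply, real_inner_smul_left, real_inner_smul_right]
    rw [sym B hB y z]
  have hpB : ∀ c : ℝ, 0 < c → ∀ v : E, 0 ≤ ⟪(c • B) v, v⟫ := by
    intro c hc v
    rw [LinearMap.smul_apply, real_inner_smul_left]
    exact mul_nonneg hc.le (hBpos v)
  constructor
  · have := main_aux (c₁ • B) A (c₁ ^ s • Bs) As (hsB _) (hpB _ hc₁) (sym A hA) hApos
      (fun x => by simpa [real_inner_smul_left] using hlow x) s hs0 hs1 (hcB _ hc₁)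
      (fun μ v _ => hfracA μ v) x
    simpa [real_inner_smul_left] using this
  · have := main_aux A (c₂ • B) As (c₂ ^ s • Bs) (sym A hA) hApos (hsB _) (hpB _ hc₂)
      (fun x => by simpa [real_inner_smul_left] using hhigh x) s hs0 hs1
      (fun μ v _ => hfracA μ v) (hcB _ hc₂) x
    simpa [real_inner_smul_left] using this
end

section
/- Let E be a finite-dimensional real inner product space, A : E → E a positive semidefinite self-adjoint linear map, δ > 0 with δ ⟨A v, v⟩ ≤ ⟨v, v⟩ for all v, α ∈ (0,1] a real number, Π : E → E a linear map, and C₁ ≥ 0 a constant such that ⟨A^{1−α} Π x, Π x⟩ ≤ C₁² δ^{α} ⟨A x, x⟩ for all x ∈ E (approximation property). Then for every integer m ≥ 1 and every x ∈ E, ⟨A (I − δA)^m Π x, (I − δA)^m Π x⟩ ≤ C₁² (α/(2m))^{α} ⟨A x, x⟩. (This is the abstract form of estimate (5.4) of the paper: combining the smoothing property of the damped Richardson smoother with the approximation property of the coarse grid correction yields a bound in the energy norm that decays like m^{−α/2}.) -/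
open RealInnerProductSpace

theorem scalar_aux (α δ l : ℝ) (hα0 : 0 < α) (hα1 : α ≤ 1) (hδ : 0 < δ) (hl : 0 ≤ l)
    (h1 : δ * l ≤ 1) (m : ℕ) (hm : 1 ≤ m) :
    δ ^ α * (l * ((1 - δ * l) ^ m) ^ 2) ≤ (α / (2 * (m : ℝ))) ^ α * l ^ (1 - α) := by
  have hm' : (0 : ℝ) < m := by exact_mod_cast hm
  have ht : 0 ≤ δ * l := by positivity
  have hsplit : l = l ^ α * l ^ (1 - α) := by
    rw [← Real.rpow_add_of_nonneg hl hα0.le (by linarith)]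
    simp
  have key : (δ * l) ^ α * ((1 - δ * l) ^ m) ^ 2 ≤ (α / (2 * (m : ℝ))) ^ α := by
    have e1 : ((1 - δ * l) ^ m) ^ 2 ≤ Real.exp (-(2 * m * (δ * l) / α)) ^ α := by
      rw [← Real.exp_mul, ← pow_mul]
      have : -(2 * m * (δ * l) / α) * α = ((m * 2 : ℕ) : ℝ) * (-(δ * l)) := by
        push_cast
        field_simp
      rw [this, Real.exp_nat_mul]
      apply pow_le_pow_left₀ (by linarith)
      have := Real.add_one_le_exp (-(δ * l))
      linarith
    calc _ ≤ (δ * l) ^ α * Real.exp (-(2 * m * (δ * l) / α)) ^ α := by gcongr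
      _ = (δ * l * Real.exp (-(2 * m * (δ * l) / α))) ^ α := by
        rw [Real.mul_rpow ht (Real.exp_pos _).le]
      _ ≤ _ := by
        apply Real.rpow_le_rpow (by positivity) _ hα0.le
        rw [Real.exp_neg, ← div_eq_mul_inv, div_le_iff₀ (Real.exp_pos _)]
        have h := Real.add_one_le_exp (2 * m * (δ * l) / α)
        calc δ * l = α / (2 * m) * (2 * m * (δ * l) / α) := by field_simp
          _ ≤ _ := by
            apply mul_le_mul_of_nonneg_left _ (by positivity)
            linarith
  calc δ ^ α * (l * ((1 - δ * l) ^ m) ^ 2)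
      = ((δ * l) ^ α * ((1 - δ * l) ^ m) ^ 2) * l ^ (1 - α) := by
        rw [Real.mul_rpow hδ.le hl]
        nth_rewrite 1 [hsplit]
        ring
    _ ≤ _ := by gcongr

/-- Abstract form of estimate (5.4): combining the smoothing property of the damped
Richardson smoother with the approximation property of the coarse grid correction yields
an energy-norm bound decaying like `m^{−α/2}`.  The fractional power `A^{1−α}` is encoded
by an operator `A1mα` acting as multiplication by `μ^{1−α}` on each eigenspace of `A`
(convention `0^0 = 1`). -/
theorem stmt12 {E : Type*} [NormedAddCommGroup E] [InnerProductSpace ℝ E]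
    [FiniteDimensional ℝ E]
    (A A1mα Pr : E →ₗ[ℝ] E)
    (hA : LinearMap.adjoint A = A)
    (hApos : ∀ v : E, 0 ≤ ⟪A v, v⟫)
    (δ : ℝ) (hδ : 0 < δ)
    (hδA : ∀ v : E, δ * ⟪A v, v⟫ ≤ ⟪v, v⟫)
    (α : ℝ) (hα0 : 0 < α) (hα1 : α ≤ 1)
    (hfrac : ∀ (μ : ℝ) (v : E), A v = μ • v → A1mα v = μ ^ (1 - α) • v)
    (C₁ : ℝ) (hC₁ : 0 ≤ C₁)
    (happrox : ∀ x : E, ⟪A1mα (Pr x), Pr x⟫ ≤ C₁ ^ 2 * δ ^ α * ⟪A x, x⟫)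
    (m : ℕ) (hm : 1 ≤ m) (x : E) :
    ⟪A ((((1 : E →ₗ[ℝ] E) - δ • A) ^ m) (Pr x)), (((1 : E →ₗ[ℝ] E) - δ • A) ^ m) (Pr x)⟫
      ≤ C₁ ^ 2 * (α / (2 * (m : ℝ))) ^ α * ⟪A x, x⟫ := by
  have hsym : A.IsSymmetric := by
    intro u v
    conv_rhs => rw [← hA]
    rw [LinearMap.adjoint_inner_right]
  set b := hsym.eigenvectorBasis rfl with hb
  set l := hsym.eigenvalues rfl with hl
  have hAb : ∀ i, A (b i) = l i • b i := fun i => by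
    exact hsym.apply_eigenvectorBasis rfl i
  have hbb : ∀ i, ⟪b i, b i⟫ = 1 := fun i => by
    rw [real_inner_self_eq_norm_sq, b.norm_eq_one]; norm_num
  have hl0 : ∀ i, 0 ≤ l i := fun i => by
    have := hApos (b i)
    rwa [hAb, real_inner_smul_left, hbb, mul_one] at this
  have hl1 : ∀ i, δ * l i ≤ 1 := fun i => by
    have := hδA (b i)
    rwa [hAb, real_inner_smul_left, hbb, mul_one] at this
  -- diagonal operators
  have diag : ∀ (T : E →ₗ[ℝ] E) (c : Fin (Module.finrank ℝ E) → ℝ), (∀ i, T (b i) = c i • b i) →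
      ∀ w i, ⟪b i, T w⟫ = c i * ⟪b i, w⟫ := by
    intro T c hT w i
    conv_lhs => rw [← b.sum_repr' w]
    rw [map_sum, inner_sum, Finset.sum_eq_single i]
    · rw [map_smul, hT, real_inner_smul_right, real_inner_smul_right, hbb]; ring
    · intro j _ hj
      rw [map_smul, hT, real_inner_smul_right, real_inner_smul_right,
        b.inner_eq_zero (Ne.symm hj)]
      ring
    · simp
  have hS : ∀ i, (((1 : E →ₗ[ℝ] E) - δ • A) ^ m) (b i) = (1 - δ * l i) ^ m • b i := by
    intro i
    clear hm
    induction m with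
    | zero => simp
    | succ k ih =>
      rw [pow_succ', Module.End.mul_apply, ih, map_smul]
      simp only [LinearMap.sub_apply, Module.End.one_apply, LinearMap.smul_apply, hAb]
      module
  have dA := diag A l hAb
  have dF := diag A1mα (fun i => l i ^ (1 - α)) (fun i => hfrac _ _ (hAb i))
  have dS := diag _ _ hS
  have hsum : ∀ u v : E, ⟪u, v⟫ = ∑ i, ⟪b i, u⟫ * ⟪b i, v⟫ := by
    intro u v
    rw [← b.sum_inner_mul_inner u v]
    exact Finset.sum_congr rfl fun i _ => by rw [real_inner_comm]
  have hδα : 0 < δ ^ α := Real.rpow_pos_of_pos hδ _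
  have main : δ ^ α * ⟪A ((((1 : E →ₗ[ℝ] E) - δ • A) ^ m) (Pr x)),
      (((1 : E →ₗ[ℝ] E) - δ • A) ^ m) (Pr x)⟫
      ≤ (α / (2 * (m : ℝ))) ^ α * ⟪A1mα (Pr x), Pr x⟫ := by
    rw [hsum, hsum (A1mα (Pr x)), Finset.mul_sum, Finset.mul_sum]
    apply Finset.sum_le_sum
    intro i _
    rw [dA, dS, dF]
    have := mul_le_mul_of_nonneg_right
      (scalar_aux α δ (l i) hα0 hα1 hδ (hl0 i) (hl1 i) m hm) (sq_nonneg ⟪b i, Pr x⟫)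
    calc _ = _ := by ring
      _ ≤ _ := this
      _ = _ := by ring
  have h2 := mul_le_mul_of_nonneg_left (happrox x)
    (show 0 ≤ (α / (2 * (m : ℝ))) ^ α by positivity)
  refine le_of_mul_le_mul_left (main.trans (h2.trans (le_of_eq ?_))) hδα
  ring
end

section
/- Let (V_k)_{k ≥ 0} be a sequence of real normed vector spaces, and fix integers m₁, m₂ ≥ 0 with M := max(1, m₁) · max(1, m₂), and a real number α > 0. For each k ≥ 1 let R_k, S_k : V_k → V_k, I_k : V_{k−1} → V_k, and P_k : V_k → V_{k−1} be bounded linear maps. Define E_0 = 0 and, for k ≥ 1, E_k = R_k^{m₂} ∘ (Id_k − I_k ∘ P_k + I_k ∘ E_{k−1} ∘ E_{k−1} ∘ P_k) ∘ S_k^{m₁}. Assume there are constants C* > 0 and C₀ > 0 such that for all k ≥ 1: the operator norm of the two-grid operator satisfies ‖R_k^{m₂} ∘ (Id_k − I_k ∘ P_k) ∘ S_k^{m₁}‖ ≤ C* M^{−α/2}, and ‖R_k^{m₂} ∘ I_k‖ ≤ C₀ and ‖P_k ∘ S_k^{m₁}‖ ≤ C₀. Then for every C† > C*, if M^{α/2}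 ≥ C₀² C†² / (C† − C*), one has ‖E_k‖ ≤ C† M^{−α/2} for every k ≥ 0. (This is the abstract perturbation argument that derives the uniform W-cycle convergence, Theorems 5.3 and 6.5 of the paper, from the two-grid estimates (5.10) and (6.40): the k-th level W-cycle error propagation operator E_k satisfies the recursion E_k = R_k^{m₂}(Id_k − I_k P_k + I_k E_{k−1}² P_k) S_k^{m₁}, and induction on k gives a uniform contraction bound once the number of smoothing steps is large enough.) -/
open ContinuousLinearMap

/-- Abstract perturbation argument behind the uniform W-cycle convergence
(Theorems 5.3 and 6.5): given the two-grid estimate and uniform bounds on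
`R_k^{m₂} ∘ I_k` and `P_k ∘ S_k^{m₁}`, the W-cycle error propagation operators `E_k`,
defined by the recursion `E_k = R_k^{m₂}(Id − I_k P_k + I_k E_{k−1}² P_k) S_k^{m₁}`
with `E_0 = 0`, satisfy `‖E_k‖ ≤ C† M^{−α/2}` for all `k`, provided
`M^{α/2} ≥ C₀² C†²/(C† − C*)` where `M = max(1,m₁)·max(1,m₂)`. -/
theorem stmt15 (V : ℕ → Type*) [∀ k, NormedAddCommGroup (V k)]
    [∀ k, NormedSpace ℝ (V k)]
    (m₁ m₂ : ℕ) (α : ℝ) (hα : 0 < α)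
    (R S : ∀ k : ℕ, V (k + 1) →L[ℝ] V (k + 1))
    (I : ∀ k : ℕ, V k →L[ℝ] V (k + 1))
    (P : ∀ k : ℕ, V (k + 1) →L[ℝ] V k)
    (E : ∀ k : ℕ, V k →L[ℝ] V k)
    (hE0 : E 0 = 0)
    (hErec : ∀ k : ℕ, E (k + 1) =
      (R k ^ m₂) ∘L (((1 : V (k + 1) →L[ℝ] V (k + 1)) - (I k) ∘L (P k))
          + (I k) ∘L (E k) ∘L (E k) ∘L (P k)) ∘L (S k ^ m₁))
    (Cstar C₀ : ℝ) (hCstar : 0 < Cstar) (hC₀ : 0 < C₀)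
    (htwogrid : ∀ k : ℕ,
      ‖(R k ^ m₂) ∘L (((1 : V (k + 1) →L[ℝ] V (k + 1)) - (I k) ∘L (P k))) ∘L (S k ^ m₁)‖
        ≤ Cstar * (((max 1 m₁ * max 1 m₂ : ℕ) : ℝ)) ^ (-(α / 2)))
    (hRI : ∀ k : ℕ, ‖(R k ^ m₂) ∘L I k‖ ≤ C₀)
    (hPS : ∀ k : ℕ, ‖(P k) ∘L (S k ^ m₁)‖ ≤ C₀)
    (Cdag : ℝ) (hCdag : Cstar < Cdag)
    (hM : C₀ ^ 2 * Cdag ^ 2 / (Cdag - Cstar)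
        ≤ (((max 1 m₁ * max 1 m₂ : ℕ) : ℝ)) ^ (α / 2)) :
    ∀ k : ℕ, ‖E k‖ ≤ Cdag * (((max 1 m₁ * max 1 m₂ : ℕ) : ℝ)) ^ (-(α / 2)) := by
  have hMpos : (0 : ℝ) < ((max 1 m₁ * max 1 m₂ : ℕ) : ℝ) := by
    have : 0 < max 1 m₁ * max 1 m₂ := by positivity
    exact_mod_cast this
  rw [Real.rpow_neg hMpos.le]
  have hy := Real.rpow_pos_of_pos hMpos (α / 2)
  simp only [Real.rpow_neg hMpos.le] at htwogrid
  generalize (((max 1 m₁ * max 1 m₂ : ℕ) : ℝ)) ^ (α / 2) = y at *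
  have hx : 0 < y⁻¹ := inv_pos.mpr hy
  have hxy : y * y⁻¹ = 1 := mul_inv_cancel₀ hy.ne'
  generalize y⁻¹ = x at *
  have hd : 0 < Cdag - Cstar := sub_pos.mpr hCdag
  have hD : 0 < Cdag := hCstar.trans hCdag
  rw [div_le_iff₀ hd] at hM
  intro k
  induction k with
  | zero => rw [hE0, norm_zero]; positivity
  | succ k ih =>
    have hsplit : E (k + 1) =
        (R k ^ m₂) ∘L (((1 : V (k + 1) →L[ℝ] V (k + 1)) - (I k) ∘L (P k))) ∘L (S k ^ m₁)
        + ((R k ^ m₂) ∘L I k) ∘L ((E k ∘L E k) ∘L ((P k) ∘L (S k ^ m₁))) := by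
      rw [hErec k]
      ext v
      simp
    have h1 : ‖((R k ^ m₂) ∘L I k) ∘L ((E k ∘L E k) ∘L ((P k) ∘L (S k ^ m₁)))‖
        ≤ C₀ * (((Cdag * x) * (Cdag * x)) * C₀) := by
      refine (opNorm_comp_le _ _).trans ?_
      refine mul_le_mul (hRI k) ?_ (norm_nonneg _) hC₀.le
      refine (opNorm_comp_le _ _).trans ?_
      refine mul_le_mul ?_ (hPS k) (norm_nonneg _) (by positivity)
      refine (opNorm_comp_le _ _).trans ?_
      exact mul_le_mul ih ih (norm_nonneg _) (by positivity)
    have h2 : C₀ * (((Cdag * x) * (Cdag * x)) * C₀) ≤ (Cdag - Cstar) * x := by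
      calc C₀ * (((Cdag * x) * (Cdag * x)) * C₀) = (C₀ ^ 2 * Cdag ^ 2) * (x * x) := by ring
        _ ≤ (y * (Cdag - Cstar)) * (x * x) := by gcongr
        _ = (Cdag - Cstar) * x * (y * x) := by ring
        _ = (Cdag - Cstar) * x := by rw [hxy, mul_one]
    rw [hsplit]
    refine (norm_add_le _ _).trans ?_
    have h3 := htwogrid k
    linarith
end
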